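/- Let (Q,I) be a gentle quiver over a field K and A = KQ/I the corresponding gentle algebra with l(A) = |Q_0| simple modules. Then the determinant of the Cartan matrix satisfies det C_A ≤ 2^{l(A)}. -/

import Mathlib

/-! Combinatorial model of a finite quiver with (quadratic monomial) relations.

For a monomial algebra `A = KQ/I` (with `I` generated by paths of length 2),
a basis of `e_i A e_j` is given by the paths from `i` to `j` avoiding the
relations, so all Cartan-type invariants are encoded combinatorially. -/

/-- A finite quiver together with a set of quadratic (length two) monomial
relations: `rel a b` means that the length-two path `ab` belongs to the
relation ideal `I`. -/
structure QuivRel where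
  /-- vertices -/
  V : Type
  /-- arrows -/
  A : Type
  [instVFin : Fintype V]
  [instVDec : DecidableEq V]
  [instAFin : Fintype A]
  [instADec : DecidableEq A]
  /-- start vertex of an arrow -/
  src : A → V
  /-- end vertex of an arrow -/
  tgt : A → V
  /-- the set of length-two zero relations -/
  rel : A → A → Prop
  rel_comp : ∀ a b, rel a b → tgt a = src b

attribute [instance] QuivRel.instVFin QuivRel.instVDec QuivRel.instAFin QuivRel.instADec

namespace QuivRel

variable (G : QuivRel)

/-- Condition (i) and (ii): `(Q,I)` is special biserial (the relation ideal `I`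
being generated by the paths of length two recorded in `rel`). -/
def SpecialBiserial : Prop :=
  (∀ v : G.V, Nat.card {a : G.A // G.src a = v} ≤ 2) ∧
  (∀ v : G.V, Nat.card {a : G.A // G.tgt a = v} ≤ 2) ∧
  (∀ a b c : G.A, G.tgt a = G.src b → ¬ G.rel a b → G.tgt a = G.src c → ¬ G.rel a c → b = c) ∧
  (∀ a b c : G.A, G.tgt b = G.src a → ¬ G.rel b a → G.tgt c = G.src a → ¬ G.rel c a → b = c)

/-- `(Q,I)` is a gentle quiver: special biserial, `I` generated by paths of
length two (built into the data), and conditions (iv). -/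
def Gentle : Prop :=
  G.SpecialBiserial ∧
  (∀ a b c : G.A, G.rel a b → G.rel a c → b = c) ∧
  (∀ a b c : G.A, G.rel b a → G.rel c a → b = c)

/-- A (composable) path all of whose length-two subpaths avoid the relations;
these are exactly the paths which are nonzero in the monomial algebra `KQ/I`. -/
def IsNonzeroPath (p : List G.A) : Prop :=
  p.Chain' (fun a b => G.tgt a = G.src b ∧ ¬ G.rel a b)

/-- Nonzero paths from `i` to `j`; the empty list is the trivial path `e_i`
(so we require `i = j` for it). -/
def IsNonzeroPathFrom (i j : G.V) (p : List G.A) : Prop :=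
  G.IsNonzeroPath p ∧ (∀ a ∈ p.head?, G.src a = i) ∧
    (∀ a ∈ p.getLast?, G.tgt a = j) ∧ (p = [] → i = j)

/-- Finite-dimensionality of `KQ/I`: nonzero paths have bounded length. -/
def FinDim : Prop := ∃ N, ∀ p : List G.A, G.IsNonzeroPath p → p.length ≤ N

/-- The `q`-Cartan matrix of `A = KQ/I`: the `(i,j)`-entry is the Poincaré
polynomial `∑_n dim_K (e_i A e_j)_n qⁿ`, i.e. each nonzero path from `i` to `j`
contributes `q^(its length)`. -/
noncomputable def qCartan : Matrix G.V G.V (Polynomial ℤ) := fun i j =>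
  ∑ᶠ n : ℕ,
    (Nat.card {p : List G.A // p.length = n ∧ G.IsNonzeroPathFrom i j p} : Polynomial ℤ) *
      Polynomial.X ^ n

/-- The ordinary Cartan matrix of `A = KQ/I`: the `(i,j)`-entry is
`dim_K e_i A e_j`, the number of nonzero paths from `i` to `j`. -/
noncomputable def cartan : Matrix G.V G.V ℤ := fun i j =>
  (Nat.card {p : List G.A // G.IsNonzeroPathFrom i j p} : ℤ)

/-- An oriented cycle with full zero relations, recorded as the (nonempty) list
of its arrows: any two cyclically consecutive arrows form a relation (this in
particular forces consecutive arrows to be composable, and the start and end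
points to agree). -/
def IsZeroCycle (p : List G.A) : Prop :=
  p ≠ [] ∧ ∀ i : Fin p.length,
    G.rel (p.get i) (p.get ⟨(i.1 + 1) % p.length,
      Nat.mod_lt _ (Nat.lt_of_le_of_lt (Nat.zero_le _) i.2)⟩)

/-- A minimal oriented cycle with full zero relations: its arrows are pairwise
distinct. -/
def IsMinZeroCycle (p : List G.A) : Prop := G.IsZeroCycle p ∧ p.Nodup

/-- Lists satisfying a property, up to cyclic rotation. Oriented cycles are
sequences of arrows up to cyclic rotation. -/
def cycleSetoid (P : List G.A → Prop) : Setoid {p : List G.A // P p} :=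
  Setoid.comap Subtype.val (List.IsRotated.setoid G.A)

/-- `c_k`, the number of minimal oriented `k`-cycles in `Q` with full zero
relations (cycles being counted up to cyclic rotation). -/
noncomputable def numCycles (k : ℕ) : ℕ :=
  Nat.card (Quotient (G.cycleSetoid (fun p => G.IsMinZeroCycle p ∧ p.length = k)))

/-- The total number of minimal oriented cycles in `Q` with full zero relations. -/
noncomputable def totalCycles : ℕ :=
  Nat.card (Quotient (G.cycleSetoid (fun p => G.IsMinZeroCycle p)))

/-- `ec(Q,I)`, the number of minimal oriented cycles with full zero relations
of even length. -/
noncomputable def ec : ℕ :=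
  Nat.card (Quotient (G.cycleSetoid (fun p => G.IsMinZeroCycle p ∧ Even p.length)))

/-- `oc(Q,I)`, the number of minimal oriented cycles with full zero relations
of odd length. -/
noncomputable def oc : ℕ :=
  Nat.card (Quotient (G.cycleSetoid (fun p => G.IsMinZeroCycle p ∧ Odd p.length)))

end QuivRel

/-- Two square matrices over a commutative ring are unimodularly equivalent if
they differ by multiplication by matrices of determinant `1` on either side. -/
def UnimodEquiv {n : Type} [Fintype n] [DecidableEq n] {R : Type} [CommRing R]
    (C D : Matrix n n R) : Prop :=
  ∃ P Q : Matrix n n R, P.det = 1 ∧ Q.det = 1 ∧ D = P * C * Q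

/-- If `N` is nilpotent over a domain, then `1 - N` has determinant `1`. -/
theorem Matrix.det_one_sub_of_isNilpotent {n R : Type*} [Fintype n] [DecidableEq n]
    [CommRing R] [IsDomain R] {N : Matrix n n R} (hN : IsNilpotent N) : (1 - N).det = 1 := by
  have h := Matrix.isNilpotent_charpoly_sub_pow_of_isNilpotent hN
  rw [isNilpotent_iff_eq_zero, sub_eq_zero] at h
  have h' := Matrix.eval_charpoly N 1
  rw [h] at h'
  simpa using h'.symm

/-- Counting lists by their first letter. -/
theorem card_list_eq_add_sum {α : Type*} [Fintype α] (φ : List α → Prop) [Decidable (φ [])]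
    (hφ : {p | φ p}.Finite) :
    Nat.card {p // φ p} = (if φ [] then 1 else 0) + ∑ a, Nat.card {q // φ (a :: q)} := by
  have : Finite {p // φ p} := hφ
  have hfin (a : α) : Finite {q // φ (a :: q)} :=
    Finite.of_injective (fun q => (⟨a :: q.1, q.2⟩ : {p // φ p})) fun q r h => by
      simpa [Subtype.ext_iff] using h
  let e : {p // φ p} ≃ PLift (φ []) ⊕ Σ a, {q // φ (a :: q)} :=
    { toFun := fun p => match p with
        | ⟨[], h⟩ => Sum.inl ⟨h⟩
        | ⟨a :: q, h⟩ => Sum.inr ⟨a, q, h⟩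
      invFun := fun s => match s with
        | Sum.inl h => ⟨[], h.down⟩
        | Sum.inr ⟨a, q, h⟩ => ⟨a :: q, h⟩
      left_inv := by rintro ⟨_ | ⟨a, q⟩, h⟩ <;> rfl
      right_inv := by rintro (h | ⟨a, q, h⟩) <;> rfl }
  rw [Nat.card_congr e, Nat.card_sum, Nat.card_sigma]
  congr 1
  split_ifs with h
  · have : Unique (PLift (φ [])) := ⟨⟨⟨h⟩⟩, fun _ => rfl⟩
    exact Nat.card_unique
  · have : IsEmpty (PLift (φ [])) := ⟨fun x => h x.down⟩
    exact Nat.card_of_isEmpty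

theorem card_subtype_and_left {α : Type*} (P : Prop) [Decidable P] (φ : α → Prop) :
    Nat.card {p // P ∧ φ p} = if P then Nat.card {p // φ p} else 0 := by
  split_ifs with h <;> simp [h]

namespace QuivRel

open scoped Classical in
/-- The matrix over `R` of length-two nonzero paths. -/
noncomputable def nonzeroMatrix (G : QuivRel) (R : Type*) [CommRing R] : Matrix G.A G.A R :=
  fun a b => if G.tgt a = G.src b ∧ ¬ G.rel a b then 1 else 0

open scoped Classical in
/-- The matrix over `R` of length-two zero relations. -/
noncomputable def relMatrix (G : QuivRel) (R : Type*) [CommRing R] : Matrix G.A G.A R :=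
  fun a b => if G.rel a b then 1 else 0

/-- The incidence matrix of start points. -/
def srcMatrix (G : QuivRel) (R : Type*) [CommRing R] : Matrix G.V G.A R :=
  fun v a => if G.src a = v then 1 else 0

/-- The incidence matrix of end points. -/
def tgtMatrix (G : QuivRel) (R : Type*) [CommRing R] : Matrix G.A G.V R :=
  fun a v => if G.tgt a = v then 1 else 0

theorem tgtMatrix_mul_srcMatrix (G : QuivRel) (R : Type*) [CommRing R] :
    G.tgtMatrix R * G.srcMatrix R = G.nonzeroMatrix R + G.relMatrix R := by
  classical
  ext a b
  have h := G.rel_comp a b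
  by_cases h1 : G.rel a b
  · simp [Matrix.mul_apply, tgtMatrix, srcMatrix, nonzeroMatrix, relMatrix, h1, h h1]
  · simp [Matrix.mul_apply, tgtMatrix, srcMatrix, nonzeroMatrix, relMatrix, h1, eq_comm]

theorem exists_path_of_pow_ne_zero (G : QuivRel) (R : Type*) [CommRing R] (n : ℕ) (a b : G.A)
    (h : (G.nonzeroMatrix R ^ n) a b ≠ 0) :
    ∃ q : List G.A, q.length = n ∧ G.IsNonzeroPath (a :: q) := by
  induction n generalizing a with
  | zero => exact ⟨[], rfl, List.isChain_singleton _⟩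
  | succ n ih =>
    rw [pow_succ', Matrix.mul_apply] at h
    obtain ⟨c, -, hc⟩ := Finset.exists_ne_zero_of_sum_ne_zero h
    obtain ⟨q, hq, hp⟩ := ih c (right_ne_zero_of_mul hc)
    refine ⟨c :: q, by simp [hq], List.isChain_cons_cons.2 ⟨?_, hp⟩⟩
    have h' := left_ne_zero_of_mul hc
    unfold nonzeroMatrix at h'
    by_contra hcon
    exact h' (if_neg hcon)

theorem isNilpotent_nonzeroMatrix (G : QuivRel) (hfd : G.FinDim) (R : Type*) [CommRing R] :
    IsNilpotent (G.nonzeroMatrix R) := by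
  obtain ⟨N, hN⟩ := hfd
  refine ⟨N, ?_⟩
  ext a b
  by_contra h
  obtain ⟨q, hq, hp⟩ := G.exists_path_of_pow_ne_zero R N a b h
  have := hN _ hp
  simp at this
  omega

theorem finite_isNonzeroPathFrom (G : QuivRel) (hfd : G.FinDim) (i j : G.V) :
    {p | G.IsNonzeroPathFrom i j p}.Finite := by
  obtain ⟨N, hN⟩ := hfd
  exact (List.finite_length_le G.A N).subset fun p hp => hN p hp.1

theorem isNonzeroPath_iff (G : QuivRel) (p : List G.A) :
    G.IsNonzeroPath p ↔ p.IsChain (fun a b => G.tgt a = G.src b ∧ ¬ G.rel a b) :=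
  Iff.rfl

theorem isNonzeroPathFrom_nil (G : QuivRel) (i j : G.V) :
    G.IsNonzeroPathFrom i j [] ↔ i = j := by
  simp [IsNonzeroPathFrom, isNonzeroPath_iff]

theorem isNonzeroPathFrom_singleton (G : QuivRel) (a : G.A) (j : G.V) :
    G.IsNonzeroPathFrom (G.src a) j [a] ↔ G.tgt a = j := by
  simp [IsNonzeroPathFrom, isNonzeroPath_iff]

theorem isNonzeroPathFrom_cons (G : QuivRel) (i j : G.V) (a : G.A) (q : List G.A) :
    G.IsNonzeroPathFrom i j (a :: q) ↔
      G.src a = i ∧ G.IsNonzeroPathFrom (G.src a) j (a :: q) := by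
  simp only [IsNonzeroPathFrom, List.head?_cons, Option.mem_def, Option.some.injEq,
    forall_eq', reduceCtorEq, false_imp_iff, and_true, true_and]
  tauto

theorem isNonzeroPathFrom_cons_cons (G : QuivRel) (j : G.V) (a b : G.A) (q : List G.A) :
    G.IsNonzeroPathFrom (G.src a) j (a :: b :: q) ↔
      (G.tgt a = G.src b ∧ ¬ G.rel a b) ∧ G.IsNonzeroPathFrom (G.src b) j (b :: q) := by
  simp [IsNonzeroPathFrom, isNonzeroPath_iff, and_assoc]

/-- The matrix whose `(a, j)` entry counts the nonzero paths with first arrow `a` and end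
point `j`. -/
noncomputable def pathMatrix (G : QuivRel) : Matrix G.A G.V ℤ := fun a j =>
  (Nat.card {q : List G.A // G.IsNonzeroPathFrom (G.src a) j (a :: q)} : ℤ)

theorem cartan_eq (G : QuivRel) (hfd : G.FinDim) :
    G.cartan = 1 + G.srcMatrix ℤ * G.pathMatrix := by
  classical
  ext i j
  rw [cartan, card_list_eq_add_sum _ (G.finite_isNonzeroPathFrom hfd i j), Matrix.add_apply,
    Matrix.mul_apply]
  simp_rw [G.isNonzeroPathFrom_cons i, card_subtype_and_left, isNonzeroPathFrom_nil]
  simp [Matrix.one_apply, srcMatrix, pathMatrix]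

theorem pathMatrix_eq (G : QuivRel) (hfd : G.FinDim) :
    G.pathMatrix = G.tgtMatrix ℤ + G.nonzeroMatrix ℤ * G.pathMatrix := by
  classical
  ext a j
  have hfin : {q | G.IsNonzeroPathFrom (G.src a) j (a :: q)}.Finite :=
    (G.finite_isNonzeroPathFrom hfd (G.src a) j).preimage (List.cons_injective.injOn)
  rw [pathMatrix, card_list_eq_add_sum _ hfin, Matrix.add_apply, Matrix.mul_apply]
  simp_rw [isNonzeroPathFrom_cons_cons, card_subtype_and_left, isNonzeroPathFrom_singleton]
  simp [tgtMatrix, nonzeroMatrix, pathMatrix]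

theorem det_cartan (G : QuivRel) (hfd : G.FinDim) :
    G.cartan.det = (1 + G.relMatrix ℤ).det := by
  have h : (1 - G.nonzeroMatrix ℤ) * (1 + G.pathMatrix * G.srcMatrix ℤ) =
      1 + G.relMatrix ℤ := by
    have h1 : (1 - G.nonzeroMatrix ℤ) * G.pathMatrix = G.tgtMatrix ℤ := by
      rw [Matrix.sub_mul, Matrix.one_mul, sub_eq_iff_eq_add]
      exact G.pathMatrix_eq hfd
    rw [mul_add, mul_one, ← Matrix.mul_assoc, h1, tgtMatrix_mul_srcMatrix]
    abel
  rw [← h, Matrix.det_mul,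
    Matrix.det_one_sub_of_isNilpotent (G.isNilpotent_nonzeroMatrix hfd ℤ), one_mul,
    G.cartan_eq hfd, Matrix.det_one_add_mul_comm]

/-- A fixed vector of the relation matrix is determined by its image under the incidence
matrix of start points. -/
theorem eq_zero_of_relMatrix_mulVec_eq (G : QuivRel) (hfd : G.FinDim) {R : Type*} [CommRing R]
    {x : G.A → R} (hx : (G.relMatrix R).mulVec x = x) (hs : (G.srcMatrix R).mulVec x = 0) :
    x = 0 := by
  have h1 : (G.nonzeroMatrix R).mulVec x = -x := by
    have := congrArg (Matrix.mulVec · x) (G.tgtMatrix_mul_srcMatrix R)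
    simp only [← Matrix.mulVec_mulVec, hs, Matrix.mulVec_zero, Matrix.add_mulVec, hx] at this
    exact eq_neg_of_add_eq_zero_left this.symm
  have h2 (n : ℕ) : (G.nonzeroMatrix R ^ n).mulVec x = (-1 : R) ^ n • x := by
    induction n with
    | zero => simp
    | succ n ih => rw [pow_succ, ← Matrix.mulVec_mulVec, h1, Matrix.mulVec_neg, ih, pow_succ]; simp
  obtain ⟨n, hn⟩ := G.isNilpotent_nonzeroMatrix hfd R
  have h3 := h2 n
  rw [hn, Matrix.zero_mulVec] at h3
  rcases neg_one_pow_eq_or R n with h | h <;> rw [h] at h3 <;> simpa using h3.symm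

/-- The permutation `π` fixes every arrow outside `B` and maps each arrow `a` of `B` to an
arrow forming a zero relation with `a`. -/
def IsRelPerm (G : QuivRel) (π : Equiv.Perm G.A) (B : Finset G.A) : Prop :=
  (∀ a ∈ B, G.rel (π a) a) ∧ ∀ a ∉ B, π a = a

namespace IsRelPerm

variable {G : QuivRel} {π : Equiv.Perm G.A} {B : Finset G.A}

theorem apply_mem_iff (h : G.IsRelPerm π B) (a : G.A) : π a ∈ B ↔ a ∈ B := by
  by_cases ha : a ∈ B
  · refine iff_of_true (by_contra fun hn => ?_) ha
    have h1 := h.2 _ hn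
    exact hn (by rwa [π.injective h1])
  · rw [h.2 a ha]

theorem relMatrix_mulVec (h : G.IsRelPerm π B) (hG : G.Gentle) (R : Type*) [CommRing R] :
    (G.relMatrix R).mulVec (fun a => if a ∈ B then 1 else 0) =
      fun a => if a ∈ B then 1 else 0 := by
  classical
  ext a
  obtain ⟨c, rfl⟩ := π.surjective a
  simp only [Matrix.mulVec, dotProduct, relMatrix, h.apply_mem_iff]
  rw [Finset.sum_eq_single c]
  · by_cases hc : c ∈ B
    · simp [hc, h.1 c hc]
    · simp [hc]
  · intro b _ hbc
    by_cases hb : b ∈ B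
    · rw [if_neg, zero_mul]
      intro hr
      exact hbc (π.injective (hG.2.2 b _ _ (h.1 b hb) hr))
    · simp [hb]
  · simp

theorem perm_eq (h : G.IsRelPerm π B) (hG : G.Gentle) {σ : Equiv.Perm G.A}
    (h' : G.IsRelPerm σ B) : π = σ := by
  ext a
  by_cases ha : a ∈ B
  · exact hG.2.2 a _ _ (h.1 a ha) (h'.1 a ha)
  · rw [h.2 a ha, h'.2 a ha]

end IsRelPerm

theorem card_isRelPerm_le (G : QuivRel) (hG : G.Gentle) (hfd : G.FinDim) :
    Nat.card {x : Equiv.Perm G.A × Finset G.A // G.IsRelPerm x.1 x.2} ≤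
      2 ^ Fintype.card G.V := by
  let f : {x : Equiv.Perm G.A × Finset G.A // G.IsRelPerm x.1 x.2} → G.V → ZMod 2 :=
    fun x => (G.srcMatrix (ZMod 2)).mulVec fun a => if a ∈ x.1.2 then 1 else 0
  have hf : Function.Injective f := by
    rintro ⟨⟨π, B⟩, h⟩ ⟨⟨σ, D⟩, h'⟩ heq
    have hx := G.eq_zero_of_relMatrix_mulVec_eq hfd
      (x := (fun a => if a ∈ B then (1 : ZMod 2) else 0) - fun a => if a ∈ D then 1 else 0)
      (by rw [Matrix.mulVec_sub, h.relMatrix_mulVec hG, h'.relMatrix_mulVec hG])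
      (by rw [Matrix.mulVec_sub]; exact sub_eq_zero.2 heq)
    have hBD : B = D := by
      ext a
      have := congrFun (sub_eq_zero.1 hx) a
      by_cases h1 : a ∈ B <;> by_cases h2 : a ∈ D <;> simp_all
    subst hBD
    obtain rfl := h.perm_eq hG h'
    rfl
  simpa using Nat.card_le_card_of_injective f hf

theorem det_one_add_relMatrix_le (G : QuivRel) :
    (1 + G.relMatrix ℤ).det ≤
      Nat.card {x : Equiv.Perm G.A × Finset G.A // G.IsRelPerm x.1 x.2} := by
  classical
  have hprod (π : Equiv.Perm G.A) (B : Finset G.A) :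
      (∏ a ∈ B, G.relMatrix ℤ (π a) a) * ∏ a ∈ Finset.univ \ B, (1 : Matrix G.A G.A ℤ) (π a) a =
        if G.IsRelPerm π B then 1 else 0 := by
    simp only [relMatrix, Matrix.one_apply, Finset.prod_ite_zero, Finset.prod_const_one,
      ← ite_and, Finset.mem_sdiff, Finset.mem_univ, true_and, mul_ite, mul_one, mul_zero]
    refine if_congr ?_ rfl rfl
    rw [IsRelPerm, and_comm]
  calc (1 + G.relMatrix ℤ).det
      ≤ ∑ π : Equiv.Perm G.A, ∏ a, (1 + G.relMatrix ℤ) (π a) a := by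
        rw [Matrix.det_apply]
        refine Finset.sum_le_sum fun π _ => ?_
        have h0 : 0 ≤ ∏ a, (1 + G.relMatrix ℤ) (π a) a := by
          refine Finset.prod_nonneg fun a _ => add_nonneg ?_ ?_
          · rw [Matrix.one_apply]; split_ifs <;> simp
          · rw [relMatrix]; split_ifs <;> simp
        rcases Int.units_eq_one_or (Equiv.Perm.sign π) with h | h <;> rw [h]
        · simp
        · simpa using h0
    _ = ∑ π : Equiv.Perm G.A, ∑ B : Finset G.A, if G.IsRelPerm π B then 1 else 0 := by
        refine Finset.sum_congr rfl fun π _ => ?_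
        simp_rw [add_comm (1 : Matrix G.A G.A ℤ), Matrix.add_apply, Finset.prod_add,
          Finset.powerset_univ, hprod]
    _ = _ := by
        rw [← Fintype.sum_prod_type', Nat.card_eq_fintype_card, Fintype.card_subtype,
          Finset.sum_boole]

end QuivRel

/-- Let `(Q,I)` be a gentle quiver and `A = KQ/I` the corresponding
(finite-dimensional) gentle algebra with `l(A) = |Q_0|` simple modules.  Then
`det C_A ≤ 2 ^ l(A)`. -/
theorem cartan_det_le (G : QuivRel) (hG : G.Gentle) (hfd : G.FinDim) :
    G.cartan.det ≤ 2 ^ Fintype.card G.V := by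
  rw [G.det_cartan hfd]
  exact G.det_one_add_relMatrix_le.trans (by exact_mod_cast G.card_isRelPerm_le hG hfd)
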